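/- (Theorem 1, Lyapunov descent condition.) Let γ ∈ [0,1) and let Q and P be symmetric positive-semidefinite (m + v·nu)×(m + v·nu) real matrices with zᵀ Q z + γ² · zᵀ P z ≤ zᵀ P z for all z ∈ ℝ^{m + v·nu}. Suppose (y_s, u_s, y_s) ∈ 𝕊 and let ȳ ∈ ℝ^m be such that there exists u with (ȳ, u, γ·ȳ + (1−γ)·y_s) ∈ 𝕊 (i.e. ȳ lies in the implicit terminal set, equivalently M(ȳ, y_s, u_s) < +∞). Then there exists y⁺ ∈ ℝ^m (namely y⁺ = γ·ȳ + (1−γ)·y_s) such that M(y⁺, y_s, u_s) + V(ȳ, y⁺, y_s, u_s) ≤ M(ȳ, y_s, u_s). -/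

import Mathlib

open Matrix
open scoped ENNReal

/-- The constraint set `𝕊` of tube parameters `(y, u, y⁺)`. -/
def Sset {n nu m p v q : ℕ}
    (A : Fin p → Matrix (Fin n) (Fin n) ℝ)
    (B : Fin p → Matrix (Fin n) (Fin nu) ℝ)
    (SX : Set (Fin n → ℝ)) (SU : Set (Fin nu → ℝ))
    (F : Matrix (Fin m) (Fin n) ℝ)
    (E : Matrix (Fin q) (Fin m) ℝ)
    (V : Fin v → Matrix (Fin n) (Fin m) ℝ)
    (U : Fin v → Matrix (Fin nu) (Fin (v * nu)) ℝ)
    (d : Fin m → ℝ) :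
    Set ((Fin m → ℝ) × (Fin (v * nu) → ℝ) × (Fin m → ℝ)) :=
  {s | (∀ (i : Fin p) (j : Fin v),
        F.mulVec ((A i).mulVec ((V j).mulVec s.1) + (B i).mulVec ((U j).mulVec s.2.1)) + d
          ≤ s.2.2)
    ∧ E.mulVec s.1 ≤ 0
    ∧ (∀ j : Fin v, (V j).mulVec s.1 ∈ SX)
    ∧ (∀ j : Fin v, (U j).mulVec s.2.1 ∈ SU)}

/-- The multiplicative-uncertainty set `Δ = convh {(A₁,B₁),…,(A_p,B_p)}`. -/
def Delta {n nu p : ℕ}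
    (A : Fin p → Matrix (Fin n) (Fin n) ℝ)
    (B : Fin p → Matrix (Fin n) (Fin nu) ℝ) :
    Set (Matrix (Fin n) (Fin n) ℝ × Matrix (Fin n) (Fin nu) ℝ) :=
  {AB | ∃ θ : Fin p → ℝ, (∀ i, 0 ≤ θ i) ∧ (∑ i, θ i) = 1 ∧
    AB.1 = ∑ i, θ i • A i ∧ AB.2 = ∑ i, θ i • B i}

/-- The parametric polytope `X(y) = {x : F x ≤ y}`. -/
def Xset {n m : ℕ} (F : Matrix (Fin m) (Fin n) ℝ) (y : Fin m → ℝ) : Set (Fin n → ℝ) :=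
  {x | F.mulVec x ≤ y}

/-- Terminal cost `M(y, y_s, u_s)`, an infimum taken in `[0, +∞]` (equal to `+∞` when the
feasible set is empty). -/
noncomputable def Mterm {m k : ℕ} (γ : ℝ)
    (S : Set ((Fin m → ℝ) × (Fin k → ℝ) × (Fin m → ℝ)))
    (P : Matrix (Fin m ⊕ Fin k) (Fin m ⊕ Fin k) ℝ)
    (y ys : Fin m → ℝ) (us : Fin k → ℝ) : ℝ≥0∞ :=
  ⨅ (u : Fin k → ℝ) (_ : (y, u, γ • y + (1 - γ) • ys) ∈ S),
    ENNReal.ofReal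
      (Sum.elim (y - ys) (u - us) ⬝ᵥ P.mulVec (Sum.elim (y - ys) (u - us)))

/-- Cost-to-travel `V(y, y⁺, y_s, u_s)`, an infimum taken in `[0, +∞]` (equal to `+∞` when the
feasible set is empty). -/
noncomputable def Vtravel {m k : ℕ}
    (S : Set ((Fin m → ℝ) × (Fin k → ℝ) × (Fin m → ℝ)))
    (Q : Matrix (Fin m ⊕ Fin k) (Fin m ⊕ Fin k) ℝ)
    (y yp ys : Fin m → ℝ) (us : Fin k → ℝ) : ℝ≥0∞ :=
  ⨅ (u : Fin k → ℝ) (_ : (y, u, yp) ∈ S),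
    ENNReal.ofReal
      (Sum.elim (y - ys) (u - us) ⬝ᵥ Q.mulVec (Sum.elim (y - ys) (u - us)))

/-- The constraint set `𝕊` is convex when the state and control constraint sets are. -/
theorem convex_Sset {n nu m p v q : ℕ}
    (A : Fin p → Matrix (Fin n) (Fin n) ℝ)
    (B : Fin p → Matrix (Fin n) (Fin nu) ℝ)
    {SX : Set (Fin n → ℝ)} {SU : Set (Fin nu → ℝ)}
    (hSX : Convex ℝ SX) (hSU : Convex ℝ SU)
    (F : Matrix (Fin m) (Fin n) ℝ)
    (E : Matrix (Fin q) (Fin m) ℝ)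
    (V : Fin v → Matrix (Fin n) (Fin m) ℝ)
    (U : Fin v → Matrix (Fin nu) (Fin (v * nu)) ℝ)
    (d : Fin m → ℝ) :
    Convex ℝ (Sset A B SX SU F E V U d) := by
  rintro ⟨y₁, u₁, z₁⟩ ⟨hz₁, hE₁, hX₁, hU₁⟩ ⟨y₂, u₂, z₂⟩ ⟨hz₂, hE₂, hX₂, hU₂⟩ a b ha hb hab
  refine ⟨fun i j k => ?_, fun k => ?_, fun j => ?_, fun j => ?_⟩
  · have h₁ := mul_le_mul_of_nonneg_left (hz₁ i j k) ha
    have h₂ := mul_le_mul_of_nonneg_left (hz₂ i j k) hb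
    have hd : d k = a * d k + b * d k := by rw [← add_mul, hab, one_mul]
    simp only [Prod.smul_mk, Prod.mk_add_mk, mulVec_add, mulVec_smul, Pi.add_apply,
      Pi.smul_apply, smul_eq_mul] at h₁ h₂ ⊢
    linarith
  · have h₁ := mul_le_mul_of_nonneg_left (hE₁ k) ha
    have h₂ := mul_le_mul_of_nonneg_left (hE₂ k) hb
    simp only [Prod.smul_mk, Prod.mk_add_mk, mulVec_add, mulVec_smul, Pi.add_apply,
      Pi.smul_apply, Pi.zero_apply, smul_eq_mul, mul_zero] at h₁ h₂ ⊢
    linarith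
  · simpa [mulVec_add, mulVec_smul] using hSX (hX₁ j) (hX₂ j) ha hb hab
  · simpa [mulVec_add, mulVec_smul] using hSU (hU₁ j) (hU₂ j) ha hb hab

/-- **Theorem 1, Lyapunov descent condition.** For `γ ∈ [0,1)` and
`Q + γ²P ⪯ P` (as quadratic forms), if `(y_s,u_s,y_s) ∈ 𝕊` and `ȳ` lies in the implicit
terminal set, then there is a successor parameter `y⁺` with
`M(y⁺, y_s, u_s) + V(ȳ, y⁺, y_s, u_s) ≤ M(ȳ, y_s, u_s)`. -/
theorem Mterm_Lyapunov_descent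
    {n nu m p v q : ℕ}
    (A : Fin p → Matrix (Fin n) (Fin n) ℝ)
    (B : Fin p → Matrix (Fin n) (Fin nu) ℝ)
    (W SX : Set (Fin n → ℝ)) (SU : Set (Fin nu → ℝ))
    (hW : Convex ℝ W) (hSX : Convex ℝ SX) (hSU : Convex ℝ SU)
    (F : Matrix (Fin m) (Fin n) ℝ)
    (E : Matrix (Fin q) (Fin m) ℝ)
    (V : Fin v → Matrix (Fin n) (Fin m) ℝ)
    (U : Fin v → Matrix (Fin nu) (Fin (v * nu)) ℝ)
    (d : Fin m → ℝ)
    (hd : ∀ w ∈ W, F.mulVec w ≤ d)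
    (γ : ℝ) (hγ0 : 0 ≤ γ) (hγ1 : γ < 1)
    (Q P : Matrix (Fin m ⊕ Fin (v * nu)) (Fin m ⊕ Fin (v * nu)) ℝ)
    (hQsymm : Q.IsSymm) (hPsymm : P.IsSymm)
    (hQpsd : ∀ z : Fin m ⊕ Fin (v * nu) → ℝ, 0 ≤ z ⬝ᵥ Q.mulVec z)
    (hPpsd : ∀ z : Fin m ⊕ Fin (v * nu) → ℝ, 0 ≤ z ⬝ᵥ P.mulVec z)
    (hQP : ∀ z : Fin m ⊕ Fin (v * nu) → ℝ,
      z ⬝ᵥ Q.mulVec z + γ ^ 2 * (z ⬝ᵥ P.mulVec z) ≤ z ⬝ᵥ P.mulVec z)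
    (ys : Fin m → ℝ) (us : Fin (v * nu) → ℝ)
    (hys : (ys, us, ys) ∈ Sset A B SX SU F E V U d)
    (yb : Fin m → ℝ)
    (hyb : ∃ u : Fin (v * nu) → ℝ,
      (yb, u, γ • yb + (1 - γ) • ys) ∈ Sset A B SX SU F E V U d) :
    ∃ yp : Fin m → ℝ,
      Mterm γ (Sset A B SX SU F E V U d) P yp ys us
        + Vtravel (Sset A B SX SU F E V U d) Q yb yp ys us
        ≤ Mterm γ (Sset A B SX SU F E V U d) P yb ys us := by
  refine ⟨γ • yb + (1 - γ) • ys, le_iInf₂ fun u hu => ?_⟩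
  have hnext : (γ • yb + (1 - γ) • ys, γ • u + (1 - γ) • us,
      γ • (γ • yb + (1 - γ) • ys) + (1 - γ) • ys) ∈ Sset A B SX SU F E V U d :=
    convex_Sset A B hSX hSU F E V U d hu hys hγ0 (sub_nonneg.2 hγ1.le) (add_sub_cancel γ 1)
  set z : Fin m ⊕ Fin (v * nu) → ℝ := Sum.elim (yb - ys) (u - us)
  have hz : Sum.elim (γ • yb + (1 - γ) • ys - ys) (γ • u + (1 - γ) • us - us) = γ • z := by
    ext (k | k) <;>
      simp only [z, Sum.elim_inl, Sum.elim_inr, Pi.add_apply, Pi.sub_apply, Pi.smul_apply,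
        smul_eq_mul] <;> ring
  have hM : Mterm γ (Sset A B SX SU F E V U d) P (γ • yb + (1 - γ) • ys) ys us
      ≤ ENNReal.ofReal (γ ^ 2 * (z ⬝ᵥ P.mulVec z)) := by
    unfold Mterm
    refine (iInf₂_le (γ • u + (1 - γ) • us) hnext).trans_eq ?_
    rw [hz, mulVec_smul, smul_dotProduct, dotProduct_smul, smul_eq_mul, smul_eq_mul, sq, mul_assoc]
  have hV : Vtravel (Sset A B SX SU F E V U d) Q yb (γ • yb + (1 - γ) • ys) ys us
      ≤ ENNReal.ofReal (z ⬝ᵥ Q.mulVec z) :=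
    iInf₂_le u hu
  refine (add_le_add hM hV).trans ?_
  rw [← ENNReal.ofReal_add (mul_nonneg (sq_nonneg γ) (hPpsd z)) (hQpsd z), add_comm]
  exact ENNReal.ofReal_le_ofReal (hQP z)
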